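/- Under the path measure μ_n conditioned on the event {ω_n = free}, the expected occupation time of the free state satisfies E[K_n | ω_n = free] = (a/(a+b))·n + b·(1 − (1−a−b)ⁿ)/(a+b)². -/

import Mathlib

open Finset

/-- Transition probabilities of the two-state Markov chain on `{free, adsorbed}`,
with `true` = free and `false` = adsorbed: `p(free→free)=1−b`, `p(free→adsorbed)=b`,
`p(adsorbed→free)=a`, `p(adsorbed→adsorbed)=1−a`. -/
noncomputable def transP (a b : ℝ) : Bool → Bool → ℝ
  | true, true => 1 - b
  | true, false => b
  | false, true => a
  | false, false => 1 - a

/-- Stationary initial distribution: `π(free)=a/(a+b)`, `π(adsorbed)=b/(a+b)`. -/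
noncomputable def statDist (a b : ℝ) : Bool → ℝ
  | true => a / (a + b)
  | false => b / (a + b)

/-- The path measure `μ_n(ω) = π(ω₀) · ∏_{k=0}^{n−1} p(ω_k → ω_{k+1})` on paths
`ω : {0,…,n} → {free, adsorbed}`. -/
noncomputable def pathMeasure (a b : ℝ) (n : ℕ) (ω : Fin (n + 1) → Bool) : ℝ :=
  statDist a b (ω 0) * ∏ k : Fin n, transP a b (ω k.castSucc) (ω k.succ)

/-- The occupation time `K_n(ω) = #{k ∈ {1,…,n} : ω_k = free}` of the free state. -/
def occTime (n : ℕ) (ω : Fin (n + 1) → Bool) : ℕ :=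
  (Finset.univ.filter fun k : Fin (n + 1) => 1 ≤ (k : ℕ) ∧ ω k = true).card

/-- The set of paths that are in the free state at time `n`. -/
def freeAtEnd (n : ℕ) : Finset (Fin (n + 1) → Bool) :=
  Finset.univ.filter fun ω => ω (Fin.last n) = true

/-- Summing over paths of length `n + 1` that end in `s` amounts to summing over the state `t`
at time `n` and the paths of length `n` that end in `t`. -/
theorem sum_filter_last_eq_sum_snoc {S M : Type*} [Fintype S] [DecidableEq S] [AddCommMonoid M]
    (n : ℕ) (s : S) (f : (Fin (n + 2) → S) → M) :
    ∑ ω with ω (Fin.last (n + 1)) = s, f ω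
      = ∑ t, ∑ ω : Fin (n + 1) → S with ω (Fin.last n) = t,
          f (Fin.snoc (α := fun _ => S) ω s) := by
  rw [Finset.sum_fiberwise, Finset.sum_filter,
    ← (Fin.snocEquiv fun _ : Fin (n + 2) => S).sum_comp, Fintype.sum_prod_type]
  simp only [Fin.snocEquiv, Equiv.coe_fn_mk, Fin.snoc_last]
  rw [Finset.sum_eq_single s]
  · simp
  · intro t _ ht
    simp [ht]
  · simp

theorem pathMeasure_snoc (a b : ℝ) (n : ℕ) (ω : Fin (n + 1) → Bool) (s : Bool) :
    pathMeasure a b (n + 1) (Fin.snoc (α := fun _ => Bool) ω s)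
      = pathMeasure a b n ω * transP a b (ω (Fin.last n)) s := by
  have h0 : Fin.snoc (α := fun _ => Bool) ω s 0 = ω 0 :=
    Fin.snoc_castSucc (α := fun _ => Bool) s ω 0
  simp only [pathMeasure, Fin.prod_univ_castSucc, h0, Fin.succ_last, Fin.snoc_last,
    Fin.snoc_castSucc, ← Fin.castSucc_succ, mul_assoc]

theorem occTime_snoc (n : ℕ) (ω : Fin (n + 1) → Bool) (s : Bool) :
    occTime (n + 1) (Fin.snoc (α := fun _ => Bool) ω s) = occTime n ω + s.toNat := by
  simp only [occTime, Finset.card_filter]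
  rw [Fin.sum_univ_castSucc]
  simp only [Fin.snoc_last, Fin.snoc_castSucc, Fin.val_castSucc, Fin.val_last]
  cases s <;> simp

/-- The distribution `π` is stationary: it is the law of the state at every time `n`. -/
theorem sum_pathMeasure_filter_last {a b : ℝ} (hab : a + b ≠ 0) (n : ℕ) (s : Bool) :
    ∑ ω with ω (Fin.last n) = s, pathMeasure a b n ω = statDist a b s := by
  induction n generalizing s with
  | zero =>
    rw [Finset.sum_filter, ← (Equiv.funUnique (Fin 1) Bool).symm.sum_comp]
    simp [pathMeasure]
  | succ n ih =>
    rw [sum_filter_last_eq_sum_snoc]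
    have h (t : Bool) : ∑ ω with ω (Fin.last n) = t,
        pathMeasure a b (n + 1) (Fin.snoc (α := fun _ => Bool) ω s)
          = statDist a b t * transP a b t s := by
      rw [← ih, Finset.sum_mul]
      refine Finset.sum_congr rfl fun ω hω => ?_
      rw [pathMeasure_snoc, (Finset.mem_filter.mp hω).2]
    simp only [h, Fintype.sum_bool]
    cases s <;> simp only [statDist, transP] <;> field_simp <;> ring

theorem sum_pathMeasure_mul_occTime_succ {a b : ℝ} (hab : a + b ≠ 0) (n : ℕ) (s : Bool) :
    ∑ ω with ω (Fin.last (n + 1)) = s, pathMeasure a b (n + 1) ω * (occTime (n + 1) ω : ℝ)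
      = ∑ t, (∑ ω with ω (Fin.last n) = t, pathMeasure a b n ω * (occTime n ω : ℝ))
            * transP a b t s
        + statDist a b s * s.toNat := by
  rw [← sum_pathMeasure_filter_last hab (n + 1) s, sum_filter_last_eq_sum_snoc,
    sum_filter_last_eq_sum_snoc, Finset.sum_mul, ← Finset.sum_add_distrib]
  refine Finset.sum_congr rfl fun t _ => ?_
  rw [Finset.sum_mul, Finset.sum_mul, ← Finset.sum_add_distrib]
  refine Finset.sum_congr rfl fun ω hω => ?_
  rw [pathMeasure_snoc, occTime_snoc, (Finset.mem_filter.mp hω).2]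
  push_cast
  ring

theorem sum_pathMeasure_mul_occTime {a b : ℝ} (hab : a + b ≠ 0) (n : ℕ) (s : Bool) :
    ∑ ω with ω (Fin.last n) = s, pathMeasure a b n ω * (occTime n ω : ℝ)
      = statDist a b s * (a / (a + b) * n
          + (if s then b else -a) * (1 - (1 - a - b) ^ n) / (a + b) ^ 2) := by
  induction n generalizing s with
  | zero => simp [occTime]
  | succ n ih =>
    simp only [sum_pathMeasure_mul_occTime_succ hab, ih, Fintype.sum_bool]
    cases s <;> simp [statDist, transP, pow_succ] <;> field_simp <;> ring

/-- Under the path measure `μ_n` conditioned on the event `{ω_n = free}`,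
the expected occupation time of the free state satisfies
`E[K_n | ω_n = free] = (a/(a+b))·n + b·(1 − (1−a−b)ⁿ)/(a+b)²`. -/
theorem stmt4 (a b : ℝ) (ha : a ∈ Set.Ioo (0 : ℝ) 1) (hb : b ∈ Set.Ioo (0 : ℝ) 1)
    (n : ℕ) :
    (∑ ω ∈ freeAtEnd n, pathMeasure a b n ω * (occTime n ω : ℝ)) /
        (∑ ω ∈ freeAtEnd n, pathMeasure a b n ω)
      = (a / (a + b)) * n + b * (1 - (1 - a - b) ^ n) / (a + b) ^ 2 := by
  have hab : 0 < a + b := add_pos ha.1 hb.1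
  have hπ : statDist a b true ≠ 0 := (div_pos ha.1 hab).ne'
  rw [freeAtEnd, sum_pathMeasure_filter_last hab.ne', sum_pathMeasure_mul_occTime hab.ne',
    mul_div_cancel_left₀ _ hπ, if_pos rfl]
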